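/- Let A be a finite subset of Λ \ {0} and S* a nested set in A, and let M(S*) be the set of maximal elements of S* with respect to inclusion. Then the sublattice Λ_{S*} := Σ_{B ∈ S*} (completion of ⟨B⟩_ℤ) equals the internal direct sum ⊕_{B ∈ M(S*)} (completion of ⟨B⟩_ℤ), and Λ_{S*} is equal to its own completion (i.e. Λ_{S*} is a saturated sublattice of Λ). -/

import Mathlib

open TensorProduct

variable {Λ : Type*} [AddCommGroup Λ]

/-- The completion (saturation) `Δ̄ = {λ ∈ Λ : m • λ ∈ Δ for some m > 0}` of a sublattice. -/
def completion (Δ : Submodule ℤ Λ) : Submodule ℤ Λ where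
  carrier := {x | ∃ m : ℤ, 0 < m ∧ m • x ∈ Δ}
  zero_mem' := ⟨1, one_pos, by rw [one_smul]; exact Δ.zero_mem⟩
  add_mem' := by
    rintro a b ⟨m, hm, hma⟩ ⟨k, hk, hkb⟩
    refine ⟨m * k, mul_pos hm hk, ?_⟩
    rw [show (m * k) • (a + b) = k • (m • a) + m • (k • b) by
      rw [smul_add, mul_comm m k, mul_smul, mul_smul, smul_comm k m b]]
    exact Δ.add_mem (Δ.smul_mem _ hma) (Δ.smul_mem _ hkb)
  smul_mem' := by
    rintro c x ⟨m, hm, hmx⟩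
    exact ⟨m, hm, by rw [smul_comm]; exact Δ.smul_mem c hmx⟩

/-- The completion of the sublattice spanned by a subset `B ⊆ Λ`. -/
def zcomp (B : Set Λ) : Submodule ℤ Λ := completion (Submodule.span ℤ B)

/-- An integral decomposition of `B`: the parts (the elements of the finite family `P`)
are pairwise disjoint and nonempty, they cover `B`, and the completion of `⟨B⟩ℤ` is the
internal direct sum of the completions of the spans of the parts. -/
def IsIntegralDecomp (B : Set Λ) (P : Finset (Set Λ)) : Prop :=
  (∀ p ∈ P, p.Nonempty) ∧
  ((P : Set (Set Λ)).Pairwise fun p q => Disjoint p q) ∧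
  ⋃₀ (P : Set (Set Λ)) = B ∧
  (zcomp B = ⨆ p ∈ P, zcomp p) ∧
  iSupIndep (fun p : P => zcomp (p : Set Λ))

/-- `B` is irreducible if it admits no integral decomposition with at least two parts. -/
def IrreducibleSubset (B : Set Λ) : Prop :=
  ¬ ∃ P : Finset (Set Λ), 2 ≤ P.card ∧ IsIntegralDecomp B P

/-- The set of elements of `Λ` lying in the `ℂ`-span of `B` inside `ℂ ⊗[ℤ] Λ`. -/
def inCSpan (B : Set Λ) : Set Λ :=
  {x : Λ | (1 : ℂ) ⊗ₜ[ℤ] x ∈ Submodule.span ℂ ((fun b : Λ => (1 : ℂ) ⊗ₜ[ℤ] b) '' B)}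

/-- `B` is complete in `A` if `B = A ∩ ⟨B⟩_ℂ`. -/
def IsCompleteIn (A B : Set Λ) : Prop := B = A ∩ inCSpan B

/-- A nested set in `A`: a family of nonempty irreducible subsets of `A` such that for every
pairwise incomparable (under inclusion) finite subfamily, the union of the subfamily is
complete in `A` and the subfamily consists exactly of the parts of the integral decomposition
of the union into irreducible subsets. -/
def IsNestedIn (A : Set Λ) (S : Set (Set Λ)) : Prop :=
  (∀ B ∈ S, B.Nonempty ∧ B ⊆ A ∧ IrreducibleSubset B) ∧
  ∀ F : Finset (Set Λ), ↑F ⊆ S → F.Nonempty →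
    ((F : Set (Set Λ)).Pairwise fun p q => ¬ p ⊆ q ∧ ¬ q ⊆ p) →
    IsCompleteIn A (⋃₀ ↑F) ∧ IsIntegralDecomp (⋃₀ ↑F) F

theorem completion_mono {Δ Γ : Submodule ℤ Λ} (h : Δ ≤ Γ) : completion Δ ≤ completion Γ :=
  fun _ ⟨m, hm, hx⟩ => ⟨m, hm, h hx⟩

theorem completion_idem (Δ : Submodule ℤ Λ) : completion (completion Δ) = completion Δ := by
  ext x
  constructor
  · rintro ⟨m, hm, k, hk, hx⟩
    exact ⟨k * m, mul_pos hk hm, by rwa [mul_smul]⟩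
  · exact fun hx => ⟨1, one_pos, by rwa [one_smul]⟩

theorem completion_bot [Module.IsTorsionFree ℤ Λ] : completion (⊥ : Submodule ℤ Λ) = ⊥ := by
  refine (Submodule.eq_bot_iff _).2 ?_
  rintro x ⟨m, hm, hx⟩
  exact (smul_eq_zero.1 ((Submodule.mem_bot ℤ).1 hx)).resolve_left hm.ne'

theorem zcomp_mono {B C : Set Λ} (h : B ⊆ C) : zcomp B ≤ zcomp C :=
  completion_mono (Submodule.span_mono h)

variable [Module.Free ℤ Λ] [Module.Finite ℤ Λ]

/-- For a nested set `S` in `A`, the sublattice `Λ_S = Σ_{B ∈ S} (completion of ⟨B⟩ℤ)`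
is the internal direct sum of the completions of `⟨B⟩ℤ` over the maximal elements `B`
of `S`, and `Λ_S` is saturated. -/
theorem nested_sum_is_direct_and_saturated
    (A : Set Λ) (hAfin : A.Finite) (hA0 : (0 : Λ) ∉ A)
    (S : Set (Set Λ)) (hS : IsNestedIn A S) :
    ((⨆ B ∈ S, zcomp B) = ⨆ B ∈ {B | B ∈ S ∧ ∀ D ∈ S, B ⊆ D → B = D}, zcomp B) ∧
    iSupIndep (fun B : {B | B ∈ S ∧ ∀ D ∈ S, B ⊆ D → B = D} => zcomp (B : Set Λ)) ∧
    completion (⨆ B ∈ S, zcomp B) = ⨆ B ∈ S, zcomp B := by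
  set M : Set (Set Λ) := {B | B ∈ S ∧ ∀ D ∈ S, B ⊆ D → B = D}
  have hSfin : S.Finite := hAfin.finite_subsets.subset fun B hB => (hS.1 B hB).2.1
  have hMS : M ⊆ S := fun B hB => hB.1
  have hMfin : M.Finite := hSfin.subset hMS
  have hsup : (⨆ B ∈ S, zcomp B) = ⨆ B ∈ M, zcomp B := by
    refine le_antisymm (iSup₂_le fun B hB => ?_) (biSup_mono hMS)
    obtain ⟨C, hBC, hC⟩ := hSfin.exists_le_maximal hB
    have hCM : C ∈ M := ⟨hC.prop, fun D hD h => hC.eq_of_le hD h⟩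
    exact (zcomp_mono hBC).trans (le_biSup zcomp hCM)
  refine ⟨hsup, ?_⟩
  rw [hsup]
  rcases M.eq_empty_or_nonempty with hM | hM
  · have : IsEmpty M := Set.isEmpty_coe_sort.2 hM
    refine ⟨fun B => isEmptyElim B, ?_⟩
    simpa [hM] using completion_bot (Λ := Λ)
  · obtain ⟨-, -, -, -, heq, hind⟩ := hS.2 hMfin.toFinset (by simpa using hMS)
      (by simpa using hM) (by
        intro p hp q hq hpq
        rw [Set.Finite.coe_toFinset] at hp hq
        exact ⟨fun h => hpq (hp.2 q hq.1 h), fun h => hpq (hq.2 p hp.1 h).symm⟩)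
    simp only [Set.Finite.mem_toFinset] at heq
    let f : M → hMfin.toFinset := fun B => ⟨B, hMfin.mem_toFinset.2 B.2⟩
    have hf : Function.Injective f := fun B C h => Subtype.ext (Subtype.mk.inj h)
    have hindM := hind.comp hf
    refine ⟨hindM, ?_⟩
    rw [← heq]
    exact completion_idem _
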